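/- Under the concentration hypothesis with constant C > 0, suppose there is α₀ ∈ (0,1) such that p(a|u) ≥ α₀ for every string u and every a ∈ A (in particular p(u) ≥ α₀^{ℓ(u)} > 0 for every string u). Let f(n) > 0, and let w be a string with 0 ≤ ℓ(w) < d such that p(a|u) = p(a|w) for every a ∈ A and every string u having w as a suffix. Then there exist constants c₃ > 0 and c₄ > 0, depending only on |A|, C and α₀, such that P( χ_w(X_1^n) = 1 ) ≤ c₃ |A|^d exp( −c₄ f(n) (α₀²/|A|)^d / d ). -/

import Mathlib

open Finset Real MeasureTheory

variable {A : Type} [Fintype A] [DecidableEq A]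

/-- `N_n(w,a)`: number of occurrences of the symbol `a` preceded by the string `w`
in the sample `x`, counted for `t ∈ {d+1, …, n}`. -/
def Nwa (x : ℕ → A) (n d : ℕ) (w : List A) (a : A) : ℕ :=
  ((Finset.Icc (d + 1) n).filter
    (fun t => (∀ i : Fin w.length, x (t - w.length + i) = w.get i) ∧ x t = a)).card

/-- `N_n(w) = ∑ₐ N_n(w,a)`. -/
def Nw (x : ℕ → A) (n d : ℕ) (w : List A) : ℕ := ∑ a : A, Nwa x n d w a

/-- Empirical conditional probability `p̂_n(a|w) = N_n(w,a)/N_n(w)`. -/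
noncomputable def phat (x : ℕ → A) (n d : ℕ) (w : List A) (a : A) : ℝ :=
  (Nwa x n d w a : ℝ) / (Nw x n d w : ℝ)

/-- Maximum likelihood attached to `w`:
`P̂_{ML,w}(x₁ⁿ) = ∏ₐ p̂_n(a|w) ^ N_n(w,a)` (convention `0⁰ = 1`). -/
noncomputable def Pml (x : ℕ → A) (n d : ℕ) (w : List A) : ℝ :=
  ∏ a : A, phat x n d w a ^ Nwa x n d w a

/-- `s ≺ w` : `s` is a proper suffix of `w`, i.e. `w = u ++ s` with `u` nonempty. -/
def PSuffix (s w : List A) : Prop := s <:+ w ∧ s ≠ w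

/-- The value `V_w(x₁ⁿ)` of the context tree maximizing procedure, defined by
backward recursion starting from the strings of length `d`; factors `V_{aw}` with
`N_n(aw) = 0` are taken equal to `1`. -/
noncomputable def V (x : ℕ → A) (n d : ℕ) (f : ℝ) (w : List A) : ℝ :=
  if h : w.length < d then
    max (Real.exp (-f) * Pml x n d w)
      (∏ a : A, if 1 ≤ Nw x n d (a :: w) then V x n d f (a :: w) else 1)
  else Real.exp (-f) * Pml x n d w
  termination_by d - w.length
  decreasing_by simp only [List.length_cons]; omega

open Classical in
/-- The indicator `χ_w(x₁ⁿ)`: equal to `1` when `N_n(w) ≥ 1`, `ℓ(w) < d` and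
`∏ₐ V_{aw}(x₁ⁿ) > e^{-f(n)} P̂_{ML,w}(x₁ⁿ)`, and `0` otherwise. -/
noncomputable def chi (x : ℕ → A) (n d : ℕ) (f : ℝ) (w : List A) : ℕ :=
  if 1 ≤ Nw x n d w ∧ w.length < d ∧
      Real.exp (-f) * Pml x n d w <
        ∏ a : A, (if 1 ≤ Nw x n d (a :: w) then V x n d f (a :: w) else 1)
  then 1 else 0

/-! ### Elementary bounds on empirical likelihoods -/

/-- Any product likelihood is dominated by the maximum likelihood. -/
theorem prod_pow_le_prod_empirical {ι : Type*} [Fintype ι]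
    (k : ι → ℕ) (q : ι → ℝ) (hq : ∀ a, 0 < q a)
    (hsum : ∑ a, q a = 1) :
    ∏ a, q a ^ k a ≤ ∏ a, ((k a : ℝ) / ((∑ b, k b : ℕ) : ℝ)) ^ k a := by
  set T : ℝ := ((∑ b, k b : ℕ) : ℝ) with hT
  have hTs : ∑ a, (k a : ℝ) = T := by rw [hT]; push_cast; rfl
  have key : ∀ a, q a ^ k a ≤ ((k a : ℝ) / T) ^ k a * exp (T * q a - k a) := by
    intro a
    rcases Nat.eq_zero_or_pos (k a) with h0 | hpos
    · have : 0 ≤ T * q a := mul_nonneg (by rw [hT]; positivity) (hq a).le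
      simpa [h0] using this
    · have hk : (0 : ℝ) < k a := by exact_mod_cast hpos
      have hTpos : 0 < T := by
        rw [← hTs]
        exact hk.trans_le (single_le_sum (f := fun a => (k a : ℝ))
          (fun _ _ => Nat.cast_nonneg _) (mem_univ a))
      have hle : q a ≤ (k a : ℝ) / T * exp (q a * T / k a - 1) := by
        have h := add_one_le_exp (q a * T / k a - 1)
        calc q a = (k a : ℝ) / T * (q a * T / k a - 1 + 1) := by field_simp; ring
          _ ≤ _ := by gcongr
      calc q a ^ k a ≤ ((k a : ℝ) / T * exp (q a * T / k a - 1)) ^ k a :=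
            pow_le_pow_left₀ (hq a).le hle _
        _ = _ := by
            rw [mul_pow, ← exp_nat_mul]
            congr 2
            field_simp
  calc ∏ a, q a ^ k a ≤ ∏ a, (((k a : ℝ) / T) ^ k a * exp (T * q a - k a)) :=
        prod_le_prod (fun a _ => pow_nonneg (hq a).le _) fun a _ => key a
    _ = _ := by
        rw [prod_mul_distrib, ← exp_sum, sum_sub_distrib, ← mul_sum, hsum, hTs]
        simp

/-- The maximum likelihood exceeds a product likelihood by at most the exponential of the
chi-square statistic. -/
theorem prod_empirical_le_exp_mul_prod_pow {ι : Type*} [Fintype ι]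
    (k : ι → ℕ) (q : ι → ℝ) (hq : ∀ a, 0 < q a)
    (hsum : ∑ a, q a = 1) (hk : 1 ≤ ∑ b, k b) :
    ∏ a, ((k a : ℝ) / ((∑ b, k b : ℕ) : ℝ)) ^ k a ≤
      exp (∑ a, ((k a : ℝ) - q a * ((∑ b, k b : ℕ) : ℝ)) ^ 2 /
        (q a * ((∑ b, k b : ℕ) : ℝ))) * ∏ a, q a ^ k a := by
  have hTpos : (0 : ℝ) < ((∑ b, k b : ℕ) : ℝ) := by exact_mod_cast hk
  set T : ℝ := ((∑ b, k b : ℕ) : ℝ) with hT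
  have hTs : ∑ a, (k a : ℝ) = T := by rw [hT]; push_cast; rfl
  have key : ∀ a, ((k a : ℝ) / T) ^ k a ≤
      exp (k a * (k a / (q a * T) - 1)) * q a ^ k a := by
    intro a
    have hqa := hq a
    have hle : (k a : ℝ) / T ≤ exp (k a / (q a * T) - 1) * q a := by
      have h := add_one_le_exp ((k a : ℝ) / (q a * T) - 1)
      calc (k a : ℝ) / T = (k a / (q a * T) - 1 + 1) * q a := by field_simp; ring
        _ ≤ _ := by gcongr
    calc ((k a : ℝ) / T) ^ k a ≤ (exp (k a / (q a * T) - 1) * q a) ^ k a :=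
          pow_le_pow_left₀ (by positivity) hle _
      _ = _ := by rw [mul_pow, ← exp_nat_mul]
  have hstat : ∑ a, (k a : ℝ) * (k a / (q a * T) - 1) =
      ∑ a, ((k a : ℝ) - q a * T) ^ 2 / (q a * T) := by
    have h1 : ∀ a, ((k a : ℝ) - q a * T) ^ 2 / (q a * T) =
        (k a : ℝ) * (k a / (q a * T) - 1) + (q a * T - k a) := by
      intro a
      have hqa := hq a
      field_simp
      ring
    simp_rw [h1]
    rw [sum_add_distrib, sum_sub_distrib, ← sum_mul, hsum, hTs]
    ring
  rw [← hstat, exp_sum, ← prod_mul_distrib]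
  exact prod_le_prod (fun a _ => by positivity) fun a _ => key a

/-- If all counts are close to their expected values, the chi-square statistic is at most
`f / 2`. -/
theorem chiSquare_le_half {ι : Type*} [Fintype ι]
    (k : ι → ℕ) (q : ι → ℝ) (α M ps f : ℝ) (hA : 1 < Fintype.card ι)
    (hα : 0 < α) (hq : ∀ a, α ≤ q a) (hsum : ∑ a, q a = 1) (hk : 1 ≤ ∑ b, k b)
    (hkM : ((∑ b, k b : ℕ) : ℝ) ≤ M) (hps : 0 < ps) (hps1 : ps ≤ 1) (hf : 0 < f)
    (hdev : ∀ a, |(k a : ℝ) - M * (ps * q a)| ≤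
      ps * √(α / (16 * (Fintype.card ι : ℝ) ^ 3) * f * M)) :
    ∑ a, ((k a : ℝ) - q a * ((∑ b, k b : ℕ) : ℝ)) ^ 2 /
        (q a * ((∑ b, k b : ℕ) : ℝ)) ≤ f / 2 := by
  have hTpos : (0 : ℝ) < ((∑ b, k b : ℕ) : ℝ) := by exact_mod_cast hk
  set T : ℝ := ((∑ b, k b : ℕ) : ℝ) with hT
  have hTs : ∑ a, (k a : ℝ) = T := by rw [hT]; push_cast; rfl
  have hM : 0 < M := hTpos.trans_le hkM
  set K : ℝ := (Fintype.card ι : ℝ) with hK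
  have hK1 : (1 : ℝ) ≤ K := by rw [hK]; exact_mod_cast hA.le
  have hK0 : 0 < K := by linarith
  have hq0 : ∀ a, 0 < q a := fun a => hα.trans_le (hq a)
  have hq1 : ∀ a, q a ≤ 1 := fun a => by
    rw [← hsum]; exact single_le_sum (fun b _ => (hq0 b).le) (mem_univ a)
  suffices h : ∀ a, ((k a : ℝ) - q a * T) ^ 2 / (q a * T) ≤ f / (2 * K) by
    calc _ ≤ ∑ _a : ι, f / (2 * K) := sum_le_sum fun a _ => h a
      _ = f / 2 := by
        rw [sum_const, card_univ, nsmul_eq_mul, ← hK]; field_simp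
  intro a
  have hqT : 0 < q a * T := mul_pos (hq0 a) hTpos
  rcases le_total (2 * M * K / α) f with hbig | hsmall
  · have hka : (k a : ℝ) ≤ T := by
      rw [← hTs]
      exact single_le_sum (f := fun a => (k a : ℝ)) (fun _ _ => Nat.cast_nonneg _) (mem_univ a)
    have hka0 : (0 : ℝ) ≤ k a := Nat.cast_nonneg _
    have hqT1 : q a * T ≤ T := mul_le_of_le_one_left hTpos.le (hq1 a)
    have h1 : ((k a : ℝ) - q a * T) ^ 2 ≤ T ^ 2 := by
      apply sq_le_sq'
      · linarith
      · linarith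
    have h2 : 2 * M * K ≤ f * α := (div_le_iff₀ hα).1 hbig
    have h3 : M ≤ f / (2 * K) * α := by
      rw [div_mul_eq_mul_div, le_div_iff₀ (by positivity)]; linarith
    rw [div_le_iff₀ hqT]
    have hc : 0 ≤ f / (2 * K) := by positivity
    calc _ ≤ T ^ 2 := h1
      _ = T * T := by ring
      _ ≤ M * T := by gcongr
      _ ≤ (f / (2 * K) * α) * T := by gcongr
      _ ≤ (f / (2 * K) * q a) * T := by gcongr; exact hq a
      _ = _ := by ring
  · set r := √(α / (16 * K ^ 3) * f * M) with hr
    have hr0 : 0 ≤ r := sqrt_nonneg _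
    have hr2 : r ^ 2 = α / (16 * K ^ 3) * f * M := sq_sqrt (by positivity)
    have hfα : f * α ≤ 2 * M * K := (le_div_iff₀ hα).1 hsmall
    have hrM : r ≤ M / (2 * K) := by
      apply le_of_sq_le_sq _ (by positivity)
      rw [hr2]
      calc α / (16 * K ^ 3) * f * M = (f * α) * (M / (16 * K ^ 3)) := by ring
        _ ≤ (2 * M * K) * (M / (16 * K ^ 3)) := by gcongr
        _ = M ^ 2 / (8 * K ^ 2) := by field_simp; norm_num
        _ ≤ M ^ 2 / (4 * K ^ 2) := by gcongr; norm_num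
        _ = _ := by ring
    have hTdev : |T - M * ps| ≤ K * (ps * r) := by
      have h1 : T - M * ps = ∑ b, ((k b : ℝ) - M * (ps * q b)) := by
        rw [sum_sub_distrib, hTs, ← mul_sum, ← mul_sum, hsum, mul_one]
      rw [h1]
      calc _ ≤ ∑ b, |(k b : ℝ) - M * (ps * q b)| := abs_sum_le_sum_abs _ _
        _ ≤ ∑ _b : ι, ps * r := sum_le_sum fun b _ => hdev b
        _ = _ := by rw [sum_const, card_univ, nsmul_eq_mul]
    have hKr : K * (ps * r) ≤ M * ps / 2 := by
      calc K * (ps * r) ≤ K * (ps * (M / (2 * K))) := by gcongr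
        _ = _ := by field_simp
    have hTlow : M * ps / 2 ≤ T := by
      have := (abs_le.1 hTdev).1
      linarith
    have hnum : |(k a : ℝ) - q a * T| ≤ 2 * K * (ps * r) := by
      have h1 : (k a : ℝ) - q a * T = (k a - M * (ps * q a)) - q a * (T - M * ps) := by ring
      rw [h1]
      have h2 : |q a * (T - M * ps)| ≤ K * (ps * r) := by
        rw [abs_mul, abs_of_pos (hq0 a)]
        exact (mul_le_of_le_one_left (abs_nonneg _) (hq1 a)).trans hTdev
      have h3 : ps * r ≤ K * (ps * r) := le_mul_of_one_le_left (by positivity) hK1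
      calc _ ≤ |(k a : ℝ) - M * (ps * q a)| + |q a * (T - M * ps)| := abs_sub _ _
        _ ≤ _ := by linarith [hdev a]
    rw [div_le_iff₀ hqT]
    calc ((k a : ℝ) - q a * T) ^ 2 = |(k a : ℝ) - q a * T| ^ 2 := (sq_abs _).symm
      _ ≤ (2 * K * (ps * r)) ^ 2 := by gcongr
      _ = ps * (f / (2 * K) * (α * (M * ps / 2))) := by
        rw [mul_pow, mul_pow ps, hr2]; field_simp; norm_num
      _ ≤ f / (2 * K) * (α * (M * ps / 2)) := mul_le_of_le_one_left (by positivity) hps1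
      _ ≤ f / (2 * K) * (q a * T) := by
        gcongr ?_ * ?_
        exact mul_le_mul (hq a) hTlow (by positivity) (hq0 a).le

/-! ### Counts along the context tree -/

theorem Nwa_eq_sum_cons (x : ℕ → A) (n d : ℕ) (u : List A) (a : A) (hu : u.length < d) :
    Nwa x n d u a = ∑ b, Nwa x n d (b :: u) a := by
  unfold Nwa
  rw [card_eq_sum_card_fiberwise (f := fun t => x (t - (u.length + 1))) (t := univ)
    (fun _ _ => mem_coe.2 (mem_univ _))]
  refine sum_congr rfl fun b _ => ?_
  congr 1
  ext t
  simp only [mem_filter, mem_Icc, List.length_cons]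
  rw [Fin.forall_fin_succ]
  have hshift : d + 1 ≤ t → ∀ i, t - (u.length + 1) + (i + 1) = t - u.length + i := by
    intro ht i; omega
  constructor
  · rintro ⟨⟨ht, hw, ha⟩, hb⟩
    refine ⟨ht, ⟨by simpa using hb, fun i => ?_⟩, ha⟩
    simpa [hshift ht.1] using hw i
  · rintro ⟨ht, ⟨hb, hw⟩, ha⟩
    refine ⟨⟨ht, fun i => ?_, ha⟩, by simpa using hb⟩
    simpa [hshift ht.1] using hw i

theorem Nw_le (x : ℕ → A) (n d : ℕ) (u : List A) : Nw x n d u ≤ n - d := by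
  have h : Nw x n d u = ((Icc (d + 1) n).filter
      (fun t => ∀ i : Fin u.length, x (t - u.length + i) = u.get i)).card := by
    unfold Nw Nwa
    rw [card_eq_sum_card_fiberwise (f := x) (t := univ) (fun _ _ => mem_coe.2 (mem_univ _))]
    simp only [filter_filter]
  rw [h]
  calc _ ≤ (Icc (d + 1) n).card := card_filter_le _ _
    _ = n - d := by rw [Nat.card_Icc]; omega

theorem Nwa_eq_zero_of_Nw (x : ℕ → A) (n d : ℕ) (u : List A) (h : ¬ 1 ≤ Nw x n d u) (a : A) :
    Nwa x n d u a = 0 := by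
  have h0 : Nw x n d u = 0 := by omega
  exact (sum_eq_zero_iff.1 h0) a (mem_univ a)

theorem Pml_nonneg (x : ℕ → A) (n d : ℕ) (u : List A) : 0 ≤ Pml x n d u :=
  prod_nonneg fun _ _ => pow_nonneg (div_nonneg (Nat.cast_nonneg _) (Nat.cast_nonneg _)) _

theorem Pml_congr (x : ℕ → A) (n d : ℕ) (u v : List A)
    (h : ∀ a, Nwa x n d u a = Nwa x n d v a) : Pml x n d u = Pml x n d v := by
  simp only [Pml, phat, Nw, h]

/-- Splitting a node is not profitable if its occurring children are leaves whose maximum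
likelihoods are close to the likelihood of `q`. -/
theorem prod_children_le (x : ℕ → A) (n d : ℕ) (f : ℝ) (hf : 0 < f) (u : List A) (q : A → ℝ)
    (hq : ∀ a, 0 < q a) (hsum : ∑ a, q a = 1) (hu : u.length < d) (hN : 1 ≤ Nw x n d u)
    (hgood : ∀ b, 1 ≤ Nw x n d (b :: u) →
      Pml x n d (b :: u) ≤ exp (f / 2) * ∏ a, q a ^ Nwa x n d (b :: u) a)
    (hV : ∀ b, 1 ≤ Nw x n d (b :: u) →
      V x n d f (b :: u) = exp (-f) * Pml x n d (b :: u)) :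
    ∏ b, (if 1 ≤ Nw x n d (b :: u) then V x n d f (b :: u) else 1) ≤
      exp (-f) * Pml x n d u := by
  rw [← prod_filter]
  set S := univ.filter (fun b => 1 ≤ Nw x n d (b :: u)) with hS
  have hmem : ∀ b, b ∈ S ↔ 1 ≤ Nw x n d (b :: u) := fun b => by simp [hS]
  have hsplit : ∀ a, Nwa x n d u a = ∑ b ∈ S, Nwa x n d (b :: u) a := by
    intro a
    rw [Nwa_eq_sum_cons x n d u a hu]
    refine (sum_subset (subset_univ S) fun b _ hb => ?_).symm
    exact Nwa_eq_zero_of_Nw x n d _ (fun h => hb ((hmem b).2 h)) a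
  have hne : S.card ≠ 0 := by
    intro h0
    rw [card_eq_zero] at h0
    have : Nw x n d u = 0 := sum_eq_zero fun a _ => by rw [hsplit a, h0, sum_empty]
    omega
  rcases Nat.lt_or_ge S.card 2 with h1 | h2
  · obtain ⟨b, hb⟩ := card_eq_one.1 (show S.card = 1 by omega)
    have hbS : 1 ≤ Nw x n d (b :: u) := (hmem b).1 (by rw [hb]; exact mem_singleton_self b)
    rw [hb, prod_singleton, hV b hbS,
      Pml_congr x n d u (b :: u) fun a => by rw [hsplit a, hb, sum_singleton]]
  · have hL : ∏ b ∈ S, ∏ a, q a ^ Nwa x n d (b :: u) a = ∏ a, q a ^ Nwa x n d u a := by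
      rw [prod_comm]
      refine prod_congr rfl fun a _ => ?_
      rw [prod_pow_eq_pow_sum, hsplit a]
    have hL0 : 0 ≤ ∏ a, q a ^ Nwa x n d u a := prod_nonneg fun a _ => pow_nonneg (hq a).le _
    calc ∏ b ∈ S, V x n d f (b :: u)
        ≤ ∏ b ∈ S, (exp (-(f / 2)) * ∏ a, q a ^ Nwa x n d (b :: u) a) := by
          refine prod_le_prod (fun b hb => ?_) fun b hb => ?_
          · rw [hV b ((hmem b).1 hb)]
            exact mul_nonneg (exp_pos _).le (Pml_nonneg _ _ _ _)
          · rw [hV b ((hmem b).1 hb)]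
            calc _ ≤ exp (-f) * (exp (f / 2) * ∏ a, q a ^ Nwa x n d (b :: u) a) := by
                  gcongr
                  exact hgood b ((hmem b).1 hb)
              _ = _ := by rw [← mul_assoc, ← exp_add]; congr 2; ring
      _ = exp (-(f / 2)) ^ S.card * ∏ a, q a ^ Nwa x n d u a := by
          rw [prod_mul_distrib, prod_const, hL]
      _ ≤ exp (-(f / 2)) ^ 2 * ∏ a, q a ^ Nwa x n d u a := by
          gcongr ?_ * _
          exact pow_le_pow_of_le_one (exp_pos _).le (exp_le_one_iff.2 (by linarith)) h2
      _ = exp (-f) * ∏ a, q a ^ Nwa x n d u a := by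
          rw [← exp_nat_mul]; congr 2; push_cast; ring
      _ ≤ exp (-f) * Pml x n d u := by
          gcongr
          exact prod_pow_le_prod_empirical _ q hq hsum

theorem V_eq_leaf (x : ℕ → A) (n d : ℕ) (f : ℝ) (hf : 0 < f) (w : List A) (q : A → ℝ)
    (hq : ∀ a, 0 < q a) (hsum : ∑ a, q a = 1)
    (hgood : ∀ u, w <:+ u → u.length ≤ d → 1 ≤ Nw x n d u →
      Pml x n d u ≤ exp (f / 2) * ∏ a, q a ^ Nwa x n d u a) (m : ℕ) :
    ∀ u, w <:+ u → u.length + m = d → 1 ≤ Nw x n d u →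
      V x n d f u = exp (-f) * Pml x n d u := by
  induction m with
  | zero =>
    intro u _ hlen _
    rw [V, dif_neg (by omega)]
  | succ m ih =>
    intro u hw hlen hN
    rw [V, dif_pos (by omega)]
    refine max_eq_left (prod_children_le x n d f hf u q hq hsum (by omega) hN ?_ ?_)
    · exact fun b => hgood _ (hw.trans (List.suffix_cons b u))
        (by simp only [List.length_cons]; omega)
    · exact fun b => ih _ (hw.trans (List.suffix_cons b u))
        (by simp only [List.length_cons]; omega)

theorem chi_ne_one (x : ℕ → A) (n d : ℕ) (f : ℝ) (hf : 0 < f) (w : List A) (q : A → ℝ)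
    (hq : ∀ a, 0 < q a) (hsum : ∑ a, q a = 1)
    (hgood : ∀ u, w <:+ u → u.length ≤ d → 1 ≤ Nw x n d u →
      Pml x n d u ≤ exp (f / 2) * ∏ a, q a ^ Nwa x n d u a) :
    chi x n d f w ≠ 1 := by
  unfold chi
  split_ifs with h
  · obtain ⟨hN, hlen, hlt⟩ := h
    refine absurd hlt (not_lt.2 (prod_children_le x n d f hf w q hq hsum hlen hN ?_ ?_))
    · exact fun b => hgood _ (List.suffix_cons b w) hlen
    · exact fun b => V_eq_leaf x n d f hf w q hq hsum hgood (d - (w.length + 1)) _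
        (List.suffix_cons b w) (by simp only [List.length_cons]; omega)
  · exact zero_ne_one

theorem pow_length_le {β : Type*} (p : List β → ℝ) (α : ℝ) (hα : 0 < α)
    (hp1 : p [] = 1) (hlow : ∀ u a, α ≤ p (u ++ [a]) / p u) (u : List β) :
    α ^ u.length ≤ p u := by
  induction u using List.reverseRecOn with
  | nil => simp [hp1]
  | append_singleton u a ih =>
    have hpu : 0 < p u := (pow_pos hα _).trans_le ih
    have h := (le_div_iff₀ hpu).1 (hlow u a)
    rw [List.length_append, List.length_singleton, pow_succ']
    exact (mul_le_mul_of_nonneg_left ih hα.le).trans h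

theorem sum_range_pow_le {K : ℕ} (hK : 2 ≤ K) (d : ℕ) :
    ∑ i ∈ range (d + 1), K ^ i ≤ 2 * K ^ d := by
  induction d with
  | zero => simp
  | succ d ih =>
    rw [sum_range_succ, pow_succ]
    nlinarith [pow_pos (show 0 < K by omega) d]

/-- **Overestimation bound at a single node (Theorem, part (b)).**  Under the
concentration hypothesis with constant `C > 0`, if `p(a|u) ≥ α₀` for every string `u`
and every `a ∈ A` (with `0 < α₀ < 1`), then there exist constants `c₃ > 0` and
`c₄ > 0`, depending only on `|A|`, `C` and `α₀`, such that for every penalizing value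
`f(n) > 0` and every string `w` with `0 ≤ ℓ(w) < d` such that `p(a|u) = p(a|w)` for
all `a ∈ A` and all `u` having `w` as a suffix,
`P(χ_w(X₁ⁿ) = 1) ≤ c₃ |A|^d exp(-c₄ f(n) (α₀²/|A|)^d / d)`. -/
theorem overestimation_bound {A : Type} [Fintype A] [DecidableEq A]
    [MeasurableSpace A] (hA : 1 < Fintype.card A)
    (C : ℝ) (hC : 0 < C) (α₀ : ℝ) (hα0 : 0 < α₀) (hα1 : α₀ < 1) :
    ∃ c₃ c₄ : ℝ, 0 < c₃ ∧ 0 < c₄ ∧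
      ∀ (Ω : Type) [MeasurableSpace Ω] (P : Measure Ω) [IsProbabilityMeasure P]
        (n d : ℕ), 0 < d → d < n →
        ∀ (X : ℕ → Ω → A), (∀ t, Measurable (X t)) →
        ∀ (p : List A → ℝ), (∀ u, 0 ≤ p u ∧ p u ≤ 1) → p ([] : List A) = 1 →
        (∀ u, p u = ∑ b : A, p (u ++ [b])) →
        (∀ (u : List A) (a : A), α₀ ≤ p (u ++ [a]) / p u) →
        (∀ u : List A, u.length ≤ d → ∀ a : A, ∀ t : ℝ, 0 < t →
          P {ω | t < |(Nwa (fun s => X s ω) n d u a : ℝ) -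
              ((n : ℝ) - d) * p (u ++ [a])|} ≤
            ENNReal.ofReal (Real.exp (1 / Real.exp 1) *
              Real.exp (-(t ^ 2 * C / (((n : ℝ) - d) * (u.length + 1)))))) →
        ∀ f : ℝ, 0 < f →
        ∀ w : List A, w.length < d →
        (∀ (u : List A) (a : A), w <:+ u →
          p (u ++ [a]) / p u = p (w ++ [a]) / p w) →
        P {ω | chi (fun s => X s ω) n d f w = 1} ≤
          ENNReal.ofReal (c₃ * (Fintype.card A : ℝ) ^ d *
            Real.exp (-(c₄ * f * (α₀ ^ 2 / (Fintype.card A : ℝ)) ^ d / d))) := by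
  set K : ℝ := (Fintype.card A : ℝ) with hK
  have hK1 : (1 : ℝ) ≤ K := by rw [hK]; exact_mod_cast hA.le
  have hK0 : 0 < K := by linarith
  set κ : ℝ := α₀ / (16 * K ^ 3) with hκ
  have hκ0 : 0 < κ := by positivity
  refine ⟨2 * K * exp (1 / exp 1), κ * C / 2, by positivity, by positivity, ?_⟩
  intro Ω _ P _ n d hd hdn X _ p hp hp1 hpsum hlow hconc f hf w _ hw
  have hM : (0 : ℝ) < n - d := sub_pos.2 (by exact_mod_cast hdn)
  have hplow := pow_length_le p α₀ hα0 hp1 hlow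
  have hp0 : ∀ u, 0 < p u := fun u => (pow_pos hα0 _).trans_le (hplow u)
  set q : A → ℝ := fun a => p (w ++ [a]) / p w with hq
  have hqsum : ∑ a, q a = 1 := by
    rw [hq, ← sum_div, ← hpsum w, div_self (hp0 w).ne']
  have hqlow : ∀ a, α₀ ≤ q a := hlow w
  have hpq : ∀ u, w <:+ u → ∀ a, p (u ++ [a]) = p u * q a := by
    intro u hu a
    rw [show q a = p (u ++ [a]) / p u from (hw u a hu).symm, mul_div_cancel₀ _ (hp0 u).ne']
  set r : ℝ := √(κ * f * (n - d)) with hr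
  have hr0 : 0 < r := sqrt_pos.2 (by positivity)
  have hr2 : r ^ 2 = κ * f * (n - d) := sq_sqrt (by positivity)
  set B : ℝ := exp (1 / exp 1) * exp (-(κ * C / 2 * f * (α₀ ^ 2 / K) ^ d / d)) with hB
  let bad : List A → A → Set Ω := fun u a =>
    {ω | p u * r < |(Nwa (fun s => X s ω) n d u a : ℝ) - ((n : ℝ) - d) * p (u ++ [a])|}
  have hbad : ∀ u, u.length ≤ d → ∀ a, P (bad u a) ≤ ENNReal.ofReal B := by
    intro u hu a
    refine (hconc u hu a _ (mul_pos (hp0 u) hr0)).trans (ENNReal.ofReal_le_ofReal ?_)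
    rw [hB]
    refine mul_le_mul_of_nonneg_left (exp_le_exp.2 (neg_le_neg ?_)) (exp_pos _).le
    have hd0 : (0 : ℝ) < d := by exact_mod_cast hd
    have hlen : (u.length : ℝ) + 1 ≤ 2 * d := by
      have h : u.length + 1 ≤ 2 * d := by omega
      exact_mod_cast h
    have hα : (α₀ ^ 2 / K) ^ d ≤ p u ^ 2 := by
      calc (α₀ ^ 2 / K) ^ d ≤ (α₀ ^ 2) ^ d := by
            gcongr
            exact div_le_self (by positivity) hK1
        _ = (α₀ ^ d) ^ 2 := by rw [← pow_mul, ← pow_mul, mul_comm]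
        _ ≤ (α₀ ^ u.length) ^ 2 := by
            gcongr ?_ ^ 2
            exact pow_le_pow_of_le_one hα0.le hα1.le hu
        _ ≤ p u ^ 2 := by
            gcongr
            exact hplow u
    calc κ * C / 2 * f * (α₀ ^ 2 / K) ^ d / d
        ≤ κ * C / 2 * f * p u ^ 2 / d := by gcongr
      _ = p u ^ 2 * κ * f * C / (2 * d) := by field_simp
      _ ≤ p u ^ 2 * κ * f * C / (u.length + 1) := by gcongr
      _ = (p u * r) ^ 2 * C / ((n - d) * (u.length + 1)) := by
          rw [mul_pow, hr2]; field_simp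
  have hsub : {ω | chi (fun s => X s ω) n d f w = 1} ⊆
      ⋃ i : (Σ j : Fin (d + 1), (Fin j → A) × A), bad (List.ofFn i.2.1) i.2.2 := by
    intro ω hω
    by_contra hnot
    refine chi_ne_one _ n d f hf w q (fun a => hα0.trans_le (hqlow a)) hqsum ?_ hω
    intro u hwu hu hN
    have hdev : ∀ a, |(Nwa (fun s => X s ω) n d u a : ℝ) - (n - d) * (p u * q a)| ≤
        p u * r := by
      intro a
      rw [← hpq u hwu a]
      by_contra! hlt
      refine hnot (Set.mem_iUnion.2 ⟨⟨⟨u.length, by omega⟩, u.get, a⟩, ?_⟩)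
      simpa only [bad, List.ofFn_get, Set.mem_ofPred_eq] using hlt
    have hNM : ((Nw (fun s => X s ω) n d u : ℕ) : ℝ) ≤ n - d := by
      rw [← Nat.cast_sub hdn.le]
      exact_mod_cast Nw_le _ n d u
    refine (prod_empirical_le_exp_mul_prod_pow _ q (fun a => hα0.trans_le (hqlow a)) hqsum
      hN).trans ?_
    gcongr
    · exact prod_nonneg fun a _ => pow_nonneg (hα0.le.trans (hqlow a)) _
    · exact chiSquare_le_half _ q α₀ (n - d) (p u) f hA hα0 hqlow hqsum hN hNM (hp0 u)
        (hp u).2 hf hdev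
  have hcard : (Fintype.card (Σ j : Fin (d + 1), (Fin j → A) × A) : ℝ) ≤ 2 * K * K ^ d := by
    have h : Fintype.card (Σ j : Fin (d + 1), (Fin j → A) × A) ≤
        2 * Fintype.card A ^ d * Fintype.card A := by
      simp only [Fintype.card_sigma, Fintype.card_prod, Fintype.card_fun, Fintype.card_fin]
      rw [← sum_mul, Fin.sum_univ_eq_sum_range (fun i => Fintype.card A ^ i)]
      exact Nat.mul_le_mul_right _ (sum_range_pow_le hA d)
    calc _ ≤ ((2 * Fintype.card A ^ d * Fintype.card A : ℕ) : ℝ) := by exact_mod_cast h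
      _ = 2 * K * K ^ d := by rw [hK]; push_cast; ring
  calc P {ω | chi (fun s => X s ω) n d f w = 1}
      ≤ ∑ i : (Σ j : Fin (d + 1), (Fin j → A) × A), P (bad (List.ofFn i.2.1) i.2.2) :=
        (measure_mono hsub).trans (measure_iUnion_fintype_le _ _)
    _ ≤ ∑ _i : (Σ j : Fin (d + 1), (Fin j → A) × A), ENNReal.ofReal B := by
        refine sum_le_sum fun i _ => hbad _ ?_ _
        rw [List.length_ofFn]
        omega
    _ = ENNReal.ofReal (Fintype.card (Σ j : Fin (d + 1), (Fin j → A) × A) * B) := by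
        rw [sum_const, card_univ, nsmul_eq_mul, ENNReal.ofReal_mul (Nat.cast_nonneg _),
          ENNReal.ofReal_natCast]
    _ ≤ ENNReal.ofReal (2 * K * K ^ d * B) := by
        refine ENNReal.ofReal_le_ofReal ?_
        gcongr
    _ = _ := by
        congr 1
        rw [hB]
        ring
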